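/- arXiv:1206.1210 — 2 statements merged into one kernel-verified Lean document; each statement's English description precedes it below -/
import Mathlib

section
/- Let f : ℝ^n → ℝ be a function that is monotone (nondecreasing) in each coordinate. Then the set of points of ℝ^n at which f is discontinuous has Lebesgue measure zero. -/
/-- **Lemma (monotone functions are almost everywhere continuous).**
Let `f : ℝⁿ → ℝ` be nondecreasing in each coordinate. Then the set of points at which `f`
is discontinuous has Lebesgue measure zero. -/
theorem monotone_ae_continuous (n : ℕ) (f : (Fin n → ℝ) → ℝ) (hf : Monotone f) :
    MeasureTheory.volume {x : Fin n → ℝ | ¬ ContinuousAt f x} = 0 := by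
  have hnull : MeasureTheory.volume (⋃ q : ℚ, frontier {y : Fin n → ℝ | (q : ℝ) ≤ f y}) = 0 := by
    refine MeasureTheory.measure_iUnion_null fun q => ?_
    have hu : IsUpperSet {y : Fin n → ℝ | (q : ℝ) ≤ f y} :=
      fun a b hab ha => le_trans (show (q : ℝ) ≤ f a from ha) (hf hab)
    exact hu.null_frontier
  refine MeasureTheory.measure_mono_null (fun x hx => ?_) hnull
  by_contra hcon
  have hfr : ∀ q : ℚ, x ∉ frontier {y : Fin n → ℝ | (q : ℝ) ≤ f y} :=
    fun q hq => hcon (Set.mem_iUnion.2 ⟨q, hq⟩)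
  refine hx (tendsto_order.2 ⟨fun a ha => ?_, fun a ha => ?_⟩)
  · obtain ⟨q, haq, hqx⟩ := exists_rat_btwn ha
    have hint : x ∈ interior {y : Fin n → ℝ | (q : ℝ) ≤ f y} := by
      by_contra h
      exact hfr q ⟨subset_closure hqx.le, h⟩
    filter_upwards [mem_interior_iff_mem_nhds.1 hint] with y hy
    exact lt_of_lt_of_le haq hy
  · obtain ⟨q, hxq, hqa⟩ := exists_rat_btwn ha
    have hcl : x ∉ closure {y : Fin n → ℝ | (q : ℝ) ≤ f y} := by
      intro h
      exact hfr q ⟨h, fun hi => by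
        have h2 : x ∈ {y : Fin n → ℝ | (q : ℝ) ≤ f y} := interior_subset hi
        exact hxq.not_ge h2⟩
    filter_upwards [isClosed_closure.isOpen_compl.mem_nhds hcl] with y hy
    exact lt_trans (not_le.1 fun h => hy (subset_closure h)) hqa
end

section
/- Let A ⊆ ℝ^n be a Borel set, let i ∈ {1,…,n}, and let ρ ∈ (0,1). Then Z^G(M_i(A), ρ) ≥ Z^G(A, ρ), where M_i is the i-shift operator; consequently Z^G(M(A), ρ) ≥ Z^G(A, ρ) for M = M_1 ∘ ⋯ ∘ M_n. -/
open MeasureTheory ProbabilityTheory Filter Pointwise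

noncomputable section

/-- The standard Gaussian measure on `ℝ`. -/
def stdGaussian : Measure ℝ := gaussianReal 0 1

/-- The `n`-fold product of the standard Gaussian measure on `ℝⁿ`. -/
def gaussianPi (n : ℕ) : Measure (Fin n → ℝ) := Measure.pi fun _ => stdGaussian

/-- Lower Minkowski content of a set `S ⊆ ℝ` w.r.t. the standard Gaussian measure. -/
def minkContent (S : Set ℝ) : ℝ :=
  Filter.liminf
    (fun r : ℝ =>
      ((stdGaussian (S + Set.Icc (-r) r)).toReal - (stdGaussian S).toReal) / r)
    (nhdsWithin 0 (Set.Ioi 0))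

/-- The restriction of `A` along the fiber of `x` in the `i`-th direction. -/
def fiber {n : ℕ} (A : Set (Fin n → ℝ)) (i : Fin n) (x : Fin n → ℝ) : Set ℝ :=
  {y : ℝ | Function.update x i y ∈ A}

/-- The geometric influence of coordinate `i` on `A`. -/
def geomInfluence {n : ℕ} (A : Set (Fin n → ℝ)) (i : Fin n) : ℝ :=
  ∫ x, minkContent (fiber A i x) ∂(gaussianPi n)

/-- A set is increasing if its indicator is nondecreasing in each coordinate. -/
def IncreasingSet {n : ℕ} (A : Set (Fin n → ℝ)) : Prop :=
  ∀ ⦃x y : Fin n → ℝ⦄, x ≤ y → x ∈ A → y ∈ A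

end


noncomputable section

/-- For a pair `p = (w, w')` of points of `ℝⁿ`, the `ρ`-noised point
`W^ρ = √(1−ρ²)·w + ρ·w'`. -/
def noised {n : ℕ} (ρ : ℝ) (p : (Fin n → ℝ) × (Fin n → ℝ)) : Fin n → ℝ :=
  fun i => Real.sqrt (1 - ρ ^ 2) * p.1 i + ρ * p.2 i

/-- `Z^G(f, ρ) = E[f(W)·f(W^ρ)]` where `W, W'` are i.i.d. standard Gaussian vectors. -/
def gaussZ {n : ℕ} (f : (Fin n → ℝ) → ℝ) (ρ : ℝ) : ℝ :=
  ∫ p, f p.1 * f (noised ρ p) ∂((gaussianPi n).prod (gaussianPi n))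

/-- `VAR^G(f, ρ) = Z^G(f, ρ) − (E f(W))²`. -/
def gaussVAR {n : ℕ} (f : (Fin n → ℝ) → ℝ) (ρ : ℝ) : ℝ :=
  gaussZ f ρ - (∫ x, f x ∂(gaussianPi n)) ^ 2

end

noncomputable section

/-- The standard normal distribution function `Φ`. -/
def Phi (u : ℝ) : ℝ := (stdGaussian (Set.Iic u)).toReal

/-- The `i`-shift operator: `M_i(A) = {x : x_i ≥ Φ̄⁻¹(μ(A_i^x))}`. Since `Φ̄ = 1 − Φ` is a
strictly decreasing bijection of `ℝ` onto `(0,1)` (with `Φ̄⁻¹(0) = +∞`, `Φ̄⁻¹(1) = −∞`),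
the condition `x_i ≥ Φ̄⁻¹(a)` is expressed equivalently as `Φ̄(x_i) ≤ a`. -/
def shiftOp {n : ℕ} (i : Fin n) (A : Set (Fin n → ℝ)) : Set (Fin n → ℝ) :=
  {x | 1 - Phi (x i) ≤ (stdGaussian (fiber A i x)).toReal}

/-- The shifting operator `M = M_1 ∘ M_2 ∘ ⋯ ∘ M_n`. -/
def shiftAll (n : ℕ) (A : Set (Fin n → ℝ)) : Set (Fin n → ℝ) :=
  (List.ofFn fun i : Fin n => shiftOp i).foldr (fun m B => m B) A

end

section Aux
open Set

instance sg_prob : IsProbabilityMeasure _root_.stdGaussian := by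
  unfold _root_.stdGaussian; infer_instance

instance sg_null : NullSingletonClass _root_.stdGaussian := by
  unfold _root_.stdGaussian; exact nullSingletonClass_gaussianReal one_ne_zero

lemma sg_ac : _root_.stdGaussian ≪ volume := gaussianReal_absolutelyContinuous 0 one_ne_zero

lemma sg_ac' : volume ≪ _root_.stdGaussian := gaussianReal_absolutelyContinuous' 0 one_ne_zero

instance sg_open : _root_.stdGaussian.IsOpenPosMeasure := sg_ac'.isOpenPosMeasure

lemma Phi_eq (a : ℝ) : Phi a = _root_.stdGaussian.real (Iic a) := rfl

lemma Phi_strictMono : StrictMono Phi := by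
  intro a b hab
  have h : _root_.stdGaussian.real (Iic b) = _root_.stdGaussian.real (Iic a) + _root_.stdGaussian.real (Ioc a b) := by
    rw [← Iic_union_Ioc_eq_Iic hab.le]
    exact measureReal_union (Iic_disjoint_Ioc le_rfl) measurableSet_Ioc
  have h2 : 0 < _root_.stdGaussian.real (Ioc a b) := by
    rw [measureReal_def]
    refine ENNReal.toReal_pos ?_ (measure_ne_top _ _)
    have : 0 < _root_.stdGaussian (Ioo a b) := isOpen_Ioo.measure_pos _ (nonempty_Ioo.2 hab)
    exact (this.trans_le (measure_mono Ioo_subset_Ioc_self)).ne'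
  rw [Phi_eq, Phi_eq, h]; linarith

lemma Phi_Iio (a : ℝ) : _root_.stdGaussian.real (Iio a) = Phi a := by
  rw [Phi_eq, measureReal_def, measureReal_def, measure_congr Iio_ae_eq_Iic]

lemma sg_neg (s : Set ℝ) (hs : MeasurableSet s) :
    _root_.stdGaussian.real {x | -x ∈ s} = _root_.stdGaussian.real s := by
  have h : _root_.stdGaussian.map (fun x => -x) = _root_.stdGaussian := by
    unfold _root_.stdGaussian; rw [gaussianReal_map_neg, neg_zero]
  conv_rhs => rw [← h]
  rw [map_measureReal_apply measurable_neg hs]; rfl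

lemma Phi_Ici (a : ℝ) : _root_.stdGaussian.real (Ici a) = Phi (-a) := by
  rw [Phi_eq, ← sg_neg _ measurableSet_Iic]
  congr 1; ext x; simp

lemma Phi_Ioi (a : ℝ) : _root_.stdGaussian.real (Ioi a) = Phi (-a) := by
  rw [← Phi_Ici, measureReal_def, measureReal_def, measure_congr Ioi_ae_eq_Ici]

lemma Phi_neg (a : ℝ) : Phi (-a) = 1 - Phi a := by
  rw [← Phi_Ioi, ← compl_Iic, probReal_compl_eq_one_sub measurableSet_Iic]; rfl

lemma Phi_continuous : Continuous Phi := by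
  rw [continuous_iff_continuousAt]
  intro a
  have : Phi = fun a => ∫ x, (Iic a).indicator (fun _ => (1:ℝ)) x ∂_root_.stdGaussian := by
    ext a; rw [integral_indicator_const _ measurableSet_Iic]; simp [Phi_eq]
  rw [this]
  apply continuousAt_of_dominated (bound := fun _ => 1)
  · exact Eventually.of_forall fun a =>
      (measurable_const.indicator measurableSet_Iic).aestronglyMeasurable
  · refine Eventually.of_forall fun a => Eventually.of_forall fun x => ?_
    by_cases h : x ∈ Iic a <;> simp [h]
  · exact integrable_const _
  · have : ∀ᵐ x ∂_root_.stdGaussian, x ≠ a := by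
      rw [ae_iff]; simp
    filter_upwards [this] with x hx
    rcases lt_or_gt_of_ne hx with h | h
    · have : (fun b => (Iic b).indicator (fun _ => (1:ℝ)) x) =ᶠ[nhds a] fun _ => 1 := by
        filter_upwards [eventually_gt_nhds h] with b hb
        simp [hb.le]
      exact (continuousAt_const (y := (1:ℝ))).congr this.symm
    · have : (fun b => (Iic b).indicator (fun _ => (1:ℝ)) x) =ᶠ[nhds a] fun _ => 0 := by
        filter_upwards [eventually_lt_nhds h] with b hb
        simp [hb]
      exact (continuousAt_const (y := (0:ℝ))).congr this.symm

lemma Phi_exists {q : ℝ} (h0 : 0 < q) (h1 : q < 1) : ∃ a, Phi a = q := by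
  have hb : Tendsto Phi atBot (nhds 0) := by
    convert tendsto_cdf_atBot _root_.stdGaussian using 1
    ext x; rw [cdf_eq_real]; rfl
  have ht : Tendsto Phi atTop (nhds 1) := by
    convert tendsto_cdf_atTop _root_.stdGaussian using 1
    ext x; rw [cdf_eq_real]; rfl
  obtain ⟨a, ha⟩ := (hb.eventually (eventually_lt_nhds h0)).exists
  obtain ⟨b, hb⟩ := (ht.eventually (eventually_gt_nhds h1)).exists
  exact mem_range_of_exists_le_of_exists_ge Phi_continuous ⟨a, ha.le⟩ ⟨b, hb.le⟩

lemma Phi_pos (a : ℝ) : 0 < Phi a := by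
  have := Phi_strictMono (show a - 1 < a by linarith)
  exact lt_of_le_of_lt measureReal_nonneg this

lemma Phi_lt_one (a : ℝ) : Phi a < 1 := by
  have := Phi_pos (-a); rw [Phi_neg] at this; linarith

/-- The density of the shifted Gaussian. -/
noncomputable def gw (d x : ℝ) : ℝ := Real.exp (-(d * x) - d ^ 2 / 2)

lemma gw_anti {d : ℝ} (hd : 0 ≤ d) {x y : ℝ} (h : x ≤ y) : gw d y ≤ gw d x := by
  unfold gw; gcongr

lemma gw_pos (d x : ℝ) : 0 < gw d x := Real.exp_pos _

lemma gw_int (d : ℝ) : Integrable (gw d) _root_.stdGaussian := by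
  have := (integrable_exp_mul_gaussianReal (μ := 0) (v := 1) (-d)).mul_const (Real.exp (-(d^2/2)))
  refine this.congr (Eventually.of_forall fun x => ?_)
  simp only [gw, ← Real.exp_add]; congr 1; ring

lemma sg_shift (d : ℝ) (T : Set ℝ) (hT : MeasurableSet T) :
    _root_.stdGaussian.real {z | z - d ∈ T} = ∫ x in T, gw d x ∂_root_.stdGaussian := by
  have hT' : MeasurableSet {z : ℝ | z - d ∈ T} := (measurable_id.sub_const d) hT
  have e1 : _root_.stdGaussian.real {z | z - d ∈ T}
      = ∫ x, {z | z - d ∈ T}.indicator (fun _ => (1:ℝ)) x ∂_root_.stdGaussian := by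
    rw [integral_indicator_const _ hT']; simp
  rw [e1, ← integral_indicator hT]
  unfold _root_.stdGaussian
  rw [integral_gaussianReal_eq_integral_smul one_ne_zero,
    integral_gaussianReal_eq_integral_smul one_ne_zero, ← integral_add_right_eq_self _ d]
  congr 1; ext x
  by_cases hx : x ∈ T
  · simp only [gaussianPDFReal, gw, smul_eq_mul, indicator, mem_ofPred_eq, add_sub_cancel_right, hx,
      if_true, mul_assoc, ← Real.exp_add, mul_one]
    congr 2; simp; ring
  · simp [hx]

lemma Phi_add (a d : ℝ) : Phi (a + d) = ∫ x in Iic a, gw d x ∂_root_.stdGaussian := by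
  rw [← sg_shift d _ measurableSet_Iic, Phi_eq]
  congr 1; ext x; simp

/-- Neyman-Pearson. -/
lemma np1 {d a : ℝ} (hd : 0 ≤ d) (T : Set ℝ) (hT : MeasurableSet T)
    (h : _root_.stdGaussian.real T = Phi a) : _root_.stdGaussian.real {z | z - d ∈ T} ≤ Phi (a + d) := by
  rw [sg_shift d T hT, Phi_add]
  have i1 : ∀ S : Set ℝ, MeasurableSet S → ∫ x in S, (gw d x - gw d a) ∂_root_.stdGaussian
      = ∫ x in S, gw d x ∂_root_.stdGaussian - _root_.stdGaussian.real S * gw d a := by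
    intro S hS
    rw [integral_sub (gw_int d).integrableOn (integrable_const _)]
    simp
  have key : ∫ x in T, (gw d x - gw d a) ∂_root_.stdGaussian
      ≤ ∫ x in Iic a, (gw d x - gw d a) ∂_root_.stdGaussian := by
    rw [← integral_indicator hT, ← integral_indicator measurableSet_Iic]
    have hi : Integrable (fun x => gw d x - gw d a) _root_.stdGaussian :=
      (gw_int d).sub (integrable_const _)
    refine integral_mono (hi.indicator hT) (hi.indicator measurableSet_Iic) fun x => ?_
    by_cases h1 : x ≤ a
    · have := gw_anti hd h1
      by_cases h2 : x ∈ T <;> simp [h1, h2, this]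
    · have := gw_anti hd (not_le.1 h1).le
      by_cases h2 : x ∈ T <;> simp [h1, h2, this]
  rw [i1 T hT, i1 _ measurableSet_Iic, h, ← Phi_eq] at key
  linarith

lemma np {d a : ℝ} (T : Set ℝ) (hT : MeasurableSet T)
    (h : _root_.stdGaussian.real T = Phi a) : _root_.stdGaussian.real {z | z + d ∈ T} ≤ Phi (a + |d|) := by
  rcases le_total d 0 with hd | hd
  · rw [abs_of_nonpos hd]
    simpa using np1 (d := -d) (by linarith) T hT h
  · rw [abs_of_nonneg hd]
    have hT' : MeasurableSet {x | -x ∈ T} := measurable_neg hT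
    have h2 := np1 (d := d) hd {x | -x ∈ T} hT' (by rw [sg_neg T hT, h])
    have h3 : MeasurableSet {z | z + d ∈ T} := (measurable_id.add_const d) hT
    rw [← sg_neg _ h3]
    have e : {x | -x ∈ {z | z + d ∈ T}} = {z | z - d ∈ {x | -x ∈ T}} := by
      ext x
      change -x + d ∈ T ↔ -(x - d) ∈ T
      rw [show -(x - d) = -x + d by ring]
    rw [e]; exact h2

lemma Phi_ratio {a b d : ℝ} (hab : a ≤ b) (hd : 0 ≤ d) :
    Phi (b + d) * Phi a ≤ Phi (a + d) * Phi b := by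
  have e : Phi (b + d) = Phi (a + d) + ∫ x in Ioc a b, gw d x ∂_root_.stdGaussian := by
    rw [Phi_add, Phi_add, ← Iic_union_Ioc_eq_Iic hab]
    exact setIntegral_union (Iic_disjoint_Ioc le_rfl) measurableSet_Ioc
      (gw_int d).integrableOn (gw_int d).integrableOn
  have e2 : Phi b = Phi a + _root_.stdGaussian.real (Ioc a b) := by
    rw [Phi_eq, Phi_eq, ← Iic_union_Ioc_eq_Iic hab]
    exact measureReal_union (Iic_disjoint_Ioc le_rfl) measurableSet_Ioc
  have l1 : ∫ x in Ioc a b, gw d x ∂_root_.stdGaussian ≤ _root_.stdGaussian.real (Ioc a b) * gw d a := by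
    have := setIntegral_mono_on (μ := _root_.stdGaussian) (s := Ioc a b) (f := gw d) (g := fun _ => gw d a)
      (gw_int d).integrableOn (integrable_const _) measurableSet_Ioc
      (fun x hx => gw_anti hd hx.1.le)
    simpa using this
  have l2 : Phi a * gw d a ≤ Phi (a + d) := by
    have := setIntegral_mono_on (μ := _root_.stdGaussian) (s := Iic a) (g := gw d) (f := fun _ => gw d a)
      (integrable_const _) (gw_int d).integrableOn measurableSet_Iic
      (fun x hx => gw_anti hd hx)
    rw [Phi_add]
    simpa [Phi_eq] using this
  have hm : 0 ≤ _root_.stdGaussian.real (Ioc a b) := measureReal_nonneg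
  have hp := Phi_pos a
  rw [e, e2]
  nlinarith [mul_le_mul_of_nonneg_right l1 hp.le, mul_le_mul_of_nonneg_right l2 hm]

lemma Phi_subadd {x y z d : ℝ} (hd : 0 ≤ d) (h : Phi x + Phi y = Phi z) :
    Phi (z + d) ≤ Phi (x + d) + Phi (y + d) := by
  have hx : x ≤ z := Phi_strictMono.le_iff_le.1 (by linarith [Phi_pos y])
  have hy : y ≤ z := Phi_strictMono.le_iff_le.1 (by linarith [Phi_pos x])
  have := Phi_ratio hx hd
  have := Phi_ratio hy hd
  have hz := Phi_pos z
  by_contra hc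
  push Not at hc
  have := mul_lt_mul_of_pos_right hc hz
  have e : Phi (z + d) * Phi z = Phi (z + d) * Phi x + Phi (z + d) * Phi y := by
    rw [← h]; ring
  linarith

/-- Inner parallel set. -/
def shr (d : ℝ) (U : Set ℝ) : Set ℝ := {x | Icc (x - d) (x + d) ⊆ U}

lemma shr_sub {d : ℝ} (hd : 0 < d) (U : Set ℝ) : shr d U ⊆ U := fun x hx =>
  hx ⟨by linarith, by linarith⟩

lemma iso_conn {d a : ℝ} (hd : 0 < d) {C : Set ℝ} (hC : IsPreconnected C)
    (h : _root_.stdGaussian.real C = Phi a) : _root_.stdGaussian.real (shr d C) ≤ Phi (a - d) := by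
  rcases (shr d C).eq_empty_or_nonempty with he | ⟨x0, hx0⟩
  · rw [he]; simp [(Phi_pos _).le]
  have hne : C.Nonempty := ⟨x0, shr_sub hd C hx0⟩
  by_cases hb : BddBelow C <;> by_cases ha : BddAbove C
  · have h1 := IsConnected.Ioo_csInf_csSup_subset ⟨hne, hC⟩ hb ha
    set l := sInf C
    set u := sSup C
    have h2 : shr d C ⊆ Icc (l + d) (u - d) := by
      intro x hx
      have e1 := csInf_le hb (hx (left_mem_Icc.2 (by linarith)))
      have e2 := le_csSup ha (hx (right_mem_Icc.2 (by linarith)))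
      exact ⟨by linarith, by linarith⟩
    have h3 := h2 hx0
    have hlu : l + d ≤ u - d := h3.1.trans h3.2
    have m1 : Phi u = Phi l + _root_.stdGaussian.real (Ioo l u) := by
      rw [← Phi_Iio u, Phi_eq l, ← Iic_union_Ioo_eq_Iio (show l < u by linarith)]
      exact measureReal_union (disjoint_left.2 fun x hx hx' => absurd hx'.1 (not_lt.2 hx))
        measurableSet_Ioo
    have m2 : Phi (u - d) = Phi (l + d) + _root_.stdGaussian.real (Icc (l + d) (u - d)) := by
      rw [← Phi_Iio (l + d), Phi_eq (u - d), ← Iio_union_Icc_eq_Iic hlu]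
      exact measureReal_union (disjoint_left.2 fun x hx hx' => absurd hx'.1 (not_le.2 hx))
        measurableSet_Icc
    have m3 : _root_.stdGaussian.real (shr d C) ≤ _ := measureReal_mono h2
    have m4 : _root_.stdGaussian.real (Ioo l u) ≤ _root_.stdGaussian.real C := measureReal_mono h1
    have hlt : Phi l < Phi u := Phi_strictMono (by linarith)
    obtain ⟨z, hz⟩ := Phi_exists (q := Phi l + Phi (-u))
      (by linarith [Phi_pos l, Phi_pos (-u)]) (by rw [Phi_neg]; linarith)
    have hs := Phi_subadd hd.le hz.symm
    have e1 := Phi_neg u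
    have e2 := Phi_neg (u - d)
    rw [show -(u - d) = -u + d by ring] at e2
    have e3 := Phi_neg z
    have e4 := Phi_neg (z + d)
    have hza : -z ≤ a := Phi_strictMono.le_iff_le.1 (by linarith)
    have := Phi_strictMono.monotone (show -(z + d) ≤ a - d by linarith)
    linarith
  · have h1 := hC.Ioi_csInf_subset hb ha
    set l := sInf C
    have h2 : shr d C ⊆ Ici (l + d) := by
      intro x hx
      have e1 := csInf_le hb (hx (left_mem_Icc.2 (by linarith)))
      simp only [mem_Ici]; linarith
    have m3 : _root_.stdGaussian.real (shr d C) ≤ _ := measureReal_mono h2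
    have m4 : _root_.stdGaussian.real (Ioi l) ≤ _root_.stdGaussian.real C := measureReal_mono h1
    rw [Phi_Ici] at m3
    rw [Phi_Ioi, h, Phi_strictMono.le_iff_le] at m4
    exact m3.trans (Phi_strictMono.monotone (by linarith))
  · have h1 := hC.Iio_csSup_subset hb ha
    set u := sSup C
    have h2 : shr d C ⊆ Iic (u - d) := by
      intro x hx
      have e2 := le_csSup ha (hx (right_mem_Icc.2 (by linarith)))
      simp only [mem_Iic]; linarith
    have m3 : _root_.stdGaussian.real (shr d C) ≤ _ := measureReal_mono h2
    have m4 : _root_.stdGaussian.real (Iio u) ≤ _root_.stdGaussian.real C := measureReal_mono h1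
    rw [← Phi_eq] at m3
    rw [Phi_Iio, h, Phi_strictMono.le_iff_le] at m4
    exact m3.trans (Phi_strictMono.monotone (by linarith))
  · have := hC.eq_univ_of_unbounded hb ha
    rw [this, probReal_univ] at h
    linarith [Phi_lt_one a]

lemma iso {d a : ℝ} (hd : 0 < d) {U : Set ℝ} (hU : IsOpen U)
    (h : _root_.stdGaussian.real U = Phi a) : _root_.stdGaussian.real (shr d U) ≤ Phi (a - d) := by
  set 𝒞 : Set (Set ℝ) := connectedComponentIn U '' U with h𝒞
  have hdisj : 𝒞.PairwiseDisjoint id := by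
    rintro _ ⟨x, hx, rfl⟩ _ ⟨y, hy, rfl⟩ hne
    refine disjoint_left.2 fun z hzx hzy => hne ?_
    rw [connectedComponentIn_eq hzx, connectedComponentIn_eq hzy]
  have hopen : ∀ C ∈ 𝒞, IsOpen C := by
    rintro _ ⟨x, hx, rfl⟩; exact hU.connectedComponentIn
  have hcount : 𝒞.Countable := hdisj.countable_of_isOpen hopen (by
    rintro _ ⟨x, hx, rfl⟩; exact ⟨x, mem_connectedComponentIn hx⟩)
  have hcov : U = ⋃₀ 𝒞 := by
    ext x; constructor
    · intro hx; exact ⟨_, ⟨x, hx, rfl⟩, mem_connectedComponentIn hx⟩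
    · rintro ⟨_, ⟨y, hy, rfl⟩, hx⟩; exact connectedComponentIn_subset _ _ hx
  have hsub : shr d U ⊆ ⋃ C ∈ 𝒞, shr d C := by
    intro x hx
    have hxU := shr_sub hd U hx
    refine mem_biUnion ⟨x, hxU, rfl⟩ ?_
    exact isPreconnected_Icc.subset_connectedComponentIn ⟨by linarith, by linarith⟩ hx
  set κ := Phi (a - d) / Phi a with hκ
  have hκ0 : 0 ≤ κ := div_nonneg (Phi_pos _).le (Phi_pos _).le
  have hpiece : ∀ C ∈ 𝒞, _root_.stdGaussian (shr d C) ≤ ENNReal.ofReal κ * _root_.stdGaussian C := by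
    intro C hC
    have hCU : _root_.stdGaussian.real C ≤ Phi a := by
      rw [← h]; refine measureReal_mono ?_
      rw [hcov]; exact subset_sUnion_of_mem hC
    have key : _root_.stdGaussian.real (shr d C) ≤ κ * _root_.stdGaussian.real C := by
      rcases measureReal_nonneg.eq_or_lt (a := (0:ℝ)) (b := _root_.stdGaussian.real C) with h0 | h0
      · rw [← h0, mul_zero, h0]; exact measureReal_mono (shr_sub hd C)
      · obtain ⟨b, hb⟩ := Phi_exists h0 (hCU.trans_lt (Phi_lt_one a))
        have hconn : IsPreconnected C := by
          obtain ⟨x, hx, rfl⟩ := hC; exact isPreconnected_connectedComponentIn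
        refine (iso_conn hd hconn hb.symm).trans ?_
        rw [← hb] at hCU ⊢
        have hba := Phi_strictMono.le_iff_le.1 hCU
        have := Phi_ratio (a := b - d) (b := a - d) (d := d) (by linarith) hd.le
        simp only [sub_add_cancel] at this
        rw [hκ, div_mul_eq_mul_div, le_div_iff₀ (Phi_pos a)]
        linarith
    have := ENNReal.ofReal_le_ofReal key
    rwa [ENNReal.ofReal_mul hκ0, ofReal_measureReal, ofReal_measureReal] at this
  have hfin : _root_.stdGaussian (shr d U) ≤ ENNReal.ofReal κ * _root_.stdGaussian U := by
    calc _root_.stdGaussian (shr d U) ≤ _root_.stdGaussian (⋃ C ∈ 𝒞, shr d C) := measure_mono hsub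
      _ ≤ ∑' C : 𝒞, _root_.stdGaussian (shr d C) := measure_biUnion_le _ hcount _
      _ ≤ ∑' C : 𝒞, ENNReal.ofReal κ * _root_.stdGaussian C :=
          ENNReal.tsum_le_tsum fun C => hpiece C C.2
      _ = ENNReal.ofReal κ * ∑' C : 𝒞, _root_.stdGaussian C := ENNReal.tsum_mul_left
      _ = ENNReal.ofReal κ * _root_.stdGaussian U := by
          conv_rhs => rw [hcov]
          rw [measure_sUnion hcount hdisj (fun C hC => (hopen C hC).measurableSet)]
  have := ENNReal.toReal_mono (by finiteness) hfin
  rw [ENNReal.toReal_mul, ENNReal.toReal_ofReal hκ0, ← measureReal_def, ← measureReal_def, h, hκ,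
    div_mul_cancel₀ _ (Phi_pos a).ne'] at this
  exact this

lemma prod_real_left {E : Set (ℝ × ℝ)} (hE : MeasurableSet E) :
    (_root_.stdGaussian.prod _root_.stdGaussian).real E
      = ∫ x, _root_.stdGaussian.real {y | (x, y) ∈ E} ∂_root_.stdGaussian := by
  rw [measureReal_def, Measure.prod_apply hE]
  exact (integral_toReal (measurable_measure_prodMk_left hE).aemeasurable
    (Eventually.of_forall fun x => measure_lt_top _ _)).symm

lemma prod_real_right {E : Set (ℝ × ℝ)} (hE : MeasurableSet E) :
    (_root_.stdGaussian.prod _root_.stdGaussian).real E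
      = ∫ y, _root_.stdGaussian.real {x | (x, y) ∈ E} ∂_root_.stdGaussian := by
  rw [measureReal_def, Measure.prod_apply_symm hE]
  exact (integral_toReal (measurable_measure_prodMk_right hE).aemeasurable
    (Eventually.of_forall fun x => measure_lt_top _ _)).symm

/-- Distribution function of `v`. -/
noncomputable def Lf (v : ℝ → ℝ) (y : ℝ) : ℝ := _root_.stdGaussian.real {x | v x < y}

lemma Lf_mono (v : ℝ → ℝ) : Monotone (Lf v) := fun _ _ hab =>
  measureReal_mono fun _ hx => lt_of_lt_of_le hx hab

lemma Lf_int (v : ℝ → ℝ) : Integrable (Lf v) _root_.stdGaussian := by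
  refine Integrable.of_bound (Lf_mono v).measurable.aestronglyMeasurable 1
    (Eventually.of_forall fun y => ?_)
  have h0 : 0 ≤ Lf v y := measureReal_nonneg
  rw [Real.norm_of_nonneg h0]; exact measureReal_le_one

lemma tail_formula {v : ℝ → ℝ} (hv : Measurable v) {B : Set ℝ} (hB : MeasurableSet B) :
    ∫ x, _root_.stdGaussian.real (B ∩ Iic (v x)) ∂_root_.stdGaussian
      = ∫ y in B, (1 - Lf v y) ∂_root_.stdGaussian := by
  have hE : MeasurableSet {q : ℝ × ℝ | q.2 ∈ B ∧ q.2 ≤ v q.1} :=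
    (measurable_snd hB).inter (measurableSet_le measurable_snd (hv.comp measurable_fst))
  have h1 := prod_real_left hE
  have h2 := prod_real_right hE
  rw [h1] at h2
  rw [← integral_indicator hB]
  refine Eq.trans h2 ?_
  congr 1; ext y
  by_cases hy : y ∈ B
  · rw [indicator_of_mem hy]
    have : {x | (x, y) ∈ {q : ℝ × ℝ | q.2 ∈ B ∧ q.2 ≤ v q.1}} = {x | v x < y}ᶜ := by
      ext x; simp [hy]
    rw [this, probReal_compl_eq_one_sub (measurableSet_lt hv measurable_const)]; rfl
  · rw [indicator_of_notMem hy]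
    have : {x | (x, y) ∈ {q : ℝ × ℝ | q.2 ∈ B ∧ q.2 ≤ v q.1}} = ∅ := by
      ext x; simp [hy]
    rw [this]; simp

lemma real_Icc (c w : ℝ) : _root_.stdGaussian.real (Ici c ∩ Iic w) = max (Phi w - Phi c) 0 := by
  rw [Ici_inter_Iic]
  rcases le_total c w with h | h
  · have m2 : Phi w = Phi c + _root_.stdGaussian.real (Icc c w) := by
      rw [← Phi_Iio c, Phi_eq w, ← Iio_union_Icc_eq_Iic h]
      exact measureReal_union (disjoint_left.2 fun x hx hx' => absurd hx'.1 (not_le.2 hx))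
        measurableSet_Icc
    rw [max_eq_left (by linarith [Phi_strictMono.monotone h])]; linarith
  · rw [max_eq_right (by linarith [Phi_strictMono.monotone h])]
    rcases h.eq_or_lt with rfl | h
    · simp [measureReal_def]
    · rw [Icc_eq_empty (not_le.2 h)]; simp

lemma excess {k τ : ℝ} (hk : 0 < k) {v : ℝ → ℝ} (hv : ∀ x x', v x' ≤ v x + k * |x' - x|)
    (hm : ∫ x, Phi (v x) ∂_root_.stdGaussian = ∫ x, Phi (k * x - τ) ∂_root_.stdGaussian) (c : ℝ) :
    ∫ x, max (Phi (v x) - Phi c) 0 ∂_root_.stdGaussian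
      ≤ ∫ x, max (Phi (k * x - τ) - Phi c) 0 ∂_root_.stdGaussian := by
  have hvc : Continuous v := by
    have : LipschitzWith (Real.toNNReal k) v := by
      refine LipschitzWith.of_dist_le_mul fun x y => ?_
      rw [Real.coe_toNNReal _ hk.le, Real.dist_eq, Real.dist_eq, abs_le]
      have h1 := hv x y
      have h2 := hv y x
      rw [abs_sub_comm y x] at h1
      constructor <;> linarith
    exact this.continuous
  have hwc : Continuous fun x : ℝ => k * x - τ := by fun_prop
  have hLs : ∀ y, Lf (fun x => k * x - τ) y = Phi ((y + τ) / k) := by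
    intro y
    rw [← Phi_Iio]; unfold Lf; congr 1; ext x
    simp only [mem_ofPred_eq, mem_Iio]
    rw [lt_div_iff₀ hk]; constructor <;> intro h <;> linarith
  set w : ℝ → ℝ := fun x => k * x - τ with hw
  have cross : ∀ y y', y < y' → Lf v y' < Lf w y' → Lf v y ≤ Lf w y := by
    intro y y' hyy hlt
    have hd : 0 < (y' - y) / k := div_pos (by linarith) hk
    rw [hLs] at hlt ⊢
    rcases measureReal_nonneg.eq_or_lt (a := (0:ℝ)) (b := Lf v y') with h0 | h0
    · exact (Lf_mono v hyy.le).trans (h0 ▸ (Phi_pos _).le)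
    obtain ⟨a, ha⟩ := Phi_exists h0 (hlt.trans (Phi_lt_one _))
    rw [← ha] at hlt
    have hlt' := Phi_strictMono.lt_iff_lt.1 hlt
    have hi := iso hd (isOpen_lt hvc continuous_const) ha.symm
    have hsub : {x | v x < y} ⊆ shr ((y' - y) / k) {x | v x < y'} := by
      intro x hx x' hx'
      have e1 := hv x x'
      have e2 : |x' - x| ≤ (y' - y) / k := by
        rw [abs_le]; constructor <;> linarith [hx'.1, hx'.2]
      rw [le_div_iff₀ hk] at e2
      have hx2 : v x < y := hx
      change v x' < y'
      nlinarith
    refine (measureReal_mono hsub).trans (hi.trans (Phi_strictMono.monotone ?_))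
    have : (y + τ) / k = (y' + τ) / k - (y' - y) / k := by field_simp; ring
    linarith
  have t1 : ∀ u : ℝ → ℝ, Continuous u → ∫ x, Phi (u x) ∂_root_.stdGaussian
      = ∫ y, (1 - Lf u y) ∂_root_.stdGaussian := by
    intro u hu
    have := tail_formula hu.measurable MeasurableSet.univ
    simpa [← Phi_eq] using this
  have t2 : ∀ u : ℝ → ℝ, Continuous u → ∫ x, max (Phi (u x) - Phi c) 0 ∂_root_.stdGaussian
      = ∫ y in Ici c, (1 - Lf u y) ∂_root_.stdGaussian := by
    intro u hu
    have := tail_formula hu.measurable (measurableSet_Ici (a := c))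
    simpa [real_Icc] using this
  rw [t2 v hvc, t2 w hwc]
  rw [t1 v hvc, t1 w hwc] at hm
  have iv : Integrable (fun y => 1 - Lf v y) _root_.stdGaussian :=
    (integrable_const _).sub (Lf_int v)
  have iw : Integrable (fun y => 1 - Lf w y) _root_.stdGaussian :=
    (integrable_const _).sub (Lf_int w)
  by_cases hex : ∃ y, y < c ∧ Lf w y < Lf v y
  · obtain ⟨y, hyc, hy⟩ := hex
    refine setIntegral_mono_on iv.integrableOn iw.integrableOn measurableSet_Ici fun y' hy' => ?_
    by_contra hcon
    have := cross y y' (lt_of_lt_of_le hyc hy') (by linarith)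
    linarith
  · push Not at hex
    have h1 : ∫ y in Iio c, (1 - Lf w y) ∂_root_.stdGaussian
        ≤ ∫ y in Iio c, (1 - Lf v y) ∂_root_.stdGaussian :=
      setIntegral_mono_on iw.integrableOn iv.integrableOn measurableSet_Iio fun y hy => by
        linarith [hex y hy]
    have s1 := integral_add_compl (measurableSet_Iio (a := c)) iv
    have s2 := integral_add_compl (measurableSet_Iio (a := c)) iw
    rw [compl_Iio] at s1 s2
    linarith

/-- joint probability -/
noncomputable def Jf (r σ : ℝ) (S T : Set ℝ) : ℝ :=
  (_root_.stdGaussian.prod _root_.stdGaussian).real {q | q.1 ∈ S ∧ r * q.1 + σ * q.2 ∈ T}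

noncomputable def hf (r σ : ℝ) (T : Set ℝ) (x : ℝ) : ℝ :=
  _root_.stdGaussian.real {z | r * x + σ * z ∈ T}

lemma J_meas (r σ : ℝ) {S T : Set ℝ} (hS : MeasurableSet S) (hT : MeasurableSet T) :
    MeasurableSet {q : ℝ × ℝ | q.1 ∈ S ∧ r * q.1 + σ * q.2 ∈ T} :=
  (measurable_fst hS).inter ((show Measurable fun q : ℝ × ℝ => r * q.1 + σ * q.2 by fun_prop) hT)

lemma J_eq (r σ : ℝ) {S T : Set ℝ} (hS : MeasurableSet S) (hT : MeasurableSet T) :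
    Jf r σ S T = ∫ x in S, hf r σ T x ∂_root_.stdGaussian := by
  rw [Jf, prod_real_left (J_meas r σ hS hT), ← integral_indicator hS]
  congr 1; ext x
  by_cases hx : x ∈ S <;> simp [hx, hf]

lemma hf_int (r σ : ℝ) {T : Set ℝ} (hT : MeasurableSet T) :
    Integrable (hf r σ T) _root_.stdGaussian := by
  have hm : MeasurableSet {q : ℝ × ℝ | r * q.1 + σ * q.2 ∈ T} :=
    (show Measurable fun q : ℝ × ℝ => r * q.1 + σ * q.2 by fun_prop) hT
  refine Integrable.of_bound
    (measurable_measure_prodMk_left (ν := _root_.stdGaussian) hm).ennreal_toReal.aestronglyMeasurable 1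
    (Eventually.of_forall fun y => ?_)
  have h0 : 0 ≤ hf r σ T y := measureReal_nonneg
  rw [Real.norm_of_nonneg h0]; exact measureReal_le_one

lemma marg {r σ : ℝ} (h : r ^ 2 + σ ^ 2 = 1) :
    (_root_.stdGaussian.prod _root_.stdGaussian).map (fun q : ℝ × ℝ => r * q.1 + σ * q.2)
      = _root_.stdGaussian := by
  have h1 : (fun q : ℝ × ℝ => r * q.1 + σ * q.2)
      = (fun q : ℝ × ℝ => q.1 + q.2) ∘ Prod.map (fun x => r * x) (fun x => σ * x) := by
    ext q; simp
  rw [h1, ← Measure.map_map (by fun_prop) (by fun_prop),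
    ← Measure.map_prod_map _ _ (by fun_prop) (by fun_prop)]
  unfold _root_.stdGaussian
  rw [gaussianReal_map_const_mul, gaussianReal_map_const_mul]
  have := gaussianReal_conv_gaussianReal (m₁ := r * 0) (m₂ := σ * 0)
    (v₁ := ⟨r ^ 2, sq_nonneg r⟩ * 1) (v₂ := ⟨σ ^ 2, sq_nonneg σ⟩ * 1)
  refine Eq.trans this ?_
  congr 1
  · simp
  · apply NNReal.eq
    change r ^ 2 * 1 + σ ^ 2 * 1 = 1
    rw [mul_one, mul_one]
    exact h

lemma J_univ {r σ : ℝ} (h : r ^ 2 + σ ^ 2 = 1) {T : Set ℝ} (hT : MeasurableSet T) :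
    Jf r σ univ T = _root_.stdGaussian.real T := by
  conv_rhs => rw [← marg h, map_measureReal_apply (by fun_prop) hT]
  unfold Jf; congr 1; ext q; simp

lemma J_le_right {r σ : ℝ} (h : r ^ 2 + σ ^ 2 = 1) {T : Set ℝ} (hT : MeasurableSet T) (S : Set ℝ) :
    Jf r σ S T ≤ _root_.stdGaussian.real T := by
  rw [← J_univ h hT]; exact measureReal_mono fun q hq => ⟨trivial, hq.2⟩

lemma J_univ_right (r σ : ℝ) (S : Set ℝ) :
    Jf r σ S univ = _root_.stdGaussian.real S := by
  have : {q : ℝ × ℝ | q.1 ∈ S ∧ r * q.1 + σ * q.2 ∈ univ} = S ×ˢ univ := by ext; simp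
  rw [Jf, this, measureReal_prod_prod]; simp

lemma J_le_left (r σ : ℝ) (S T : Set ℝ) :
    Jf r σ S T ≤ _root_.stdGaussian.real S := by
  rw [← J_univ_right r σ]; exact measureReal_mono fun q hq => ⟨hq.1, trivial⟩

lemma hf_pos {r σ : ℝ} (hσ : 0 < σ) {T : Set ℝ} (h : 0 < _root_.stdGaussian.real T) (x : ℝ) :
    0 < hf r σ T x := by
  refine lt_of_le_of_ne measureReal_nonneg fun h0 => ?_
  have h1 : _root_.stdGaussian {z | r * x + σ * z ∈ T} = 0 := by
    rw [hf, eq_comm, measureReal_eq_zero_iff] at h0; exact h0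
  have h2 := sg_ac' h1
  have h3 : {z | r * x + σ * z ∈ T} = (fun z => σ * z) ⁻¹' ((fun z => r * x + z) ⁻¹' T) := rfl
  rw [h3, Real.volume_preimage_mul_left hσ.ne', measure_preimage_add] at h2
  have h4 : volume T = 0 := by
    rcases mul_eq_zero.1 h2 with h | h
    · simp [hσ.ne'] at h
    · exact h
  have h5 := sg_ac h4
  rw [measureReal_def, h5] at h
  simp at h

lemma hf_Ici {r σ : ℝ} (hσ : 0 < σ) (t x : ℝ) :
    hf r σ (Ici t) x = Phi (r / σ * x - t / σ) := by
  rw [show r / σ * x - t / σ = -((t - r * x) / σ) by field_simp; ring, ← Phi_Ici]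
  unfold hf; congr 1; ext z
  simp only [mem_ofPred_eq, mem_Ici]
  rw [div_le_iff₀ hσ]; constructor <;> intro h <;> linarith

lemma borell_core {r σ : ℝ} (hr : 0 < r) (hσ : 0 < σ) (h : r ^ 2 + σ ^ 2 = 1) {S T : Set ℝ}
    (hS : MeasurableSet S) (hT : MeasurableSet T) {s t : ℝ}
    (hs : _root_.stdGaussian.real S = Phi (-s)) (ht : _root_.stdGaussian.real T = Phi (-t)) :
    Jf r σ S T ≤ Jf r σ (Ici s) (Ici t) := by
  have hk : 0 < r / σ := div_pos hr hσ
  have hmx : ∀ x, MeasurableSet {z | r * x + σ * z ∈ T} := fun x =>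
    (show Measurable fun z : ℝ => r * x + σ * z by fun_prop) hT
  have hex : ∀ x, ∃ a, Phi a = hf r σ T x := by
    intro x
    refine Phi_exists (hf_pos hσ (ht ▸ Phi_pos _) x) ?_
    have := hf_pos (r := r) hσ (T := Tᶜ)
      (by rw [probReal_compl_eq_one_sub hT, ht]; linarith [Phi_lt_one (-t)]) x
    have e : hf r σ Tᶜ x = 1 - hf r σ T x := by
      unfold hf; rw [← probReal_compl_eq_one_sub (hmx x)]; rfl
    linarith
  choose v hv using hex
  have hlip : ∀ x x', v x' ≤ v x + r / σ * |x' - x| := by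
    intro x x'
    rw [← Phi_strictMono.le_iff_le, hv]
    have := np (d := r / σ * (x' - x)) _ (hmx x) (a := v x) (hv x).symm
    rw [abs_mul, abs_of_pos hk] at this
    refine le_trans (le_of_eq ?_) this
    unfold hf; congr 1; ext z
    simp only [mem_ofPred_eq]
    rw [show r * x + σ * (z + r / σ * (x' - x)) = r * x' + σ * z by field_simp; ring]
  have hmass : ∫ x, Phi (v x) ∂_root_.stdGaussian
      = ∫ x, Phi (r / σ * x - t / σ) ∂_root_.stdGaussian := by
    simp only [hv, ← hf_Ici hσ]
    rw [← setIntegral_univ, ← setIntegral_univ (f := hf r σ (Ici t)), ← J_eq r σ .univ hT,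
      ← J_eq r σ .univ measurableSet_Ici, J_univ h hT, J_univ h measurableSet_Ici, ht, Phi_Ici]
  set c := r / σ * s - t / σ with hc
  have hexc := excess hk hlip hmass c
  simp only [hv, ← hf_Ici hσ] at hexc
  have gen : ∀ (S : Set ℝ) (T : Set ℝ), MeasurableSet S → MeasurableSet T →
      Jf r σ S T = Phi c * _root_.stdGaussian.real S
        + ∫ x, S.indicator (fun x => hf r σ T x - Phi c) x ∂_root_.stdGaussian := by
    intro S T hS hT
    rw [integral_indicator hS, integral_sub (hf_int r σ hT).integrableOn (integrable_const _),
      J_eq r σ hS hT]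
    simp; ring
  have hi : Integrable (fun x => hf r σ T x - Phi c) _root_.stdGaussian :=
    (hf_int r σ hT).sub (integrable_const _)
  rw [gen S T hS hT, gen _ _ measurableSet_Ici measurableSet_Ici, hs, Phi_Ici]
  have l1 : ∫ x, S.indicator (fun x => hf r σ T x - Phi c) x ∂_root_.stdGaussian
      ≤ ∫ x, max (hf r σ T x - Phi c) 0 ∂_root_.stdGaussian := by
    refine integral_mono (hi.indicator hS) hi.pos_part fun x => ?_
    by_cases hx : x ∈ S <;> simp [hx]
  have l2 : ∫ x, (Ici s).indicator (fun x => hf r σ (Ici t) x - Phi c) x ∂_root_.stdGaussian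
      = ∫ x, max (hf r σ (Ici t) x - Phi c) 0 ∂_root_.stdGaussian := by
    congr 1; ext x
    rw [hf_Ici hσ]
    by_cases hx : s ≤ x
    · rw [indicator_of_mem (mem_Ici.2 hx), hf_Ici hσ, max_eq_left]
      rw [sub_nonneg, Phi_strictMono.le_iff_le, hc]
      gcongr
    · rw [indicator_of_notMem (fun h' => hx (mem_Ici.1 h')), max_eq_right]
      rw [sub_nonpos, Phi_strictMono.le_iff_le, hc]
      push Not at hx
      gcongr
  linarith

/-- the half-line with the same measure -/
def half (m : ℝ) : Set ℝ := {y | 1 - Phi y ≤ m}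

lemma half_cases (S : Set ℝ) :
    (_root_.stdGaussian.real S = 0 ∧ half (_root_.stdGaussian.real S) = ∅) ∨
    (_root_.stdGaussian.real S = 1 ∧ half (_root_.stdGaussian.real S) = univ) ∨
    ∃ s, _root_.stdGaussian.real S = Phi (-s) ∧ half (_root_.stdGaussian.real S) = Ici s := by
  have h0 : 0 ≤ _root_.stdGaussian.real S := measureReal_nonneg
  have h1 : _root_.stdGaussian.real S ≤ 1 := measureReal_le_one
  rcases h0.eq_or_lt with h0 | h0
  · left
    refine ⟨h0.symm, ?_⟩
    rw [← h0]; ext y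
    simp only [half, mem_ofPred_eq, mem_empty_iff_false, iff_false]
    linarith [Phi_lt_one y]
  rcases h1.eq_or_lt with h1 | h1
  · right; left
    refine ⟨h1, ?_⟩
    rw [h1]; ext y
    simp only [half, mem_ofPred_eq, mem_univ, iff_true]
    linarith [Phi_pos y]
  · right; right
    obtain ⟨a, ha⟩ := Phi_exists h0 h1
    refine ⟨-a, by rw [neg_neg, ha], ?_⟩
    rw [← ha]; ext y
    simp only [half, mem_ofPred_eq, mem_Ici]
    rw [← Phi_neg, Phi_strictMono.le_iff_le]
    constructor <;> intro h <;> linarith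

lemma half_measure (S : Set ℝ) :
    _root_.stdGaussian.real (half (_root_.stdGaussian.real S)) = _root_.stdGaussian.real S := by
  rcases half_cases S with ⟨h, e⟩ | ⟨h, e⟩ | ⟨s, h, e⟩
  · rw [e, h]; simp
  · rw [e, h]; simp
  · rw [e, h, Phi_Ici]

lemma half_meas (m : ℝ) : MeasurableSet (half m) :=
  measurableSet_le (measurable_const.sub Phi_continuous.measurable) measurable_const

lemma borell {r σ : ℝ} (hr : 0 < r) (hσ : 0 < σ) (h : r ^ 2 + σ ^ 2 = 1) {S T : Set ℝ}
    (hS : MeasurableSet S) (hT : MeasurableSet T) :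
    Jf r σ S T ≤ Jf r σ (half (_root_.stdGaussian.real S)) (half (_root_.stdGaussian.real T)) := by
  rcases half_cases S with ⟨hs, es⟩ | ⟨hs, es⟩ | ⟨s, hs, es⟩
  · exact (J_le_left r σ S T).trans (hs ▸ measureReal_nonneg)
  · rw [es, J_univ h (half_meas _), half_measure]
    exact J_le_right h hT S
  rcases half_cases T with ⟨ht, et⟩ | ⟨ht, et⟩ | ⟨t, ht, et⟩
  · exact (J_le_right h hT S).trans (ht ▸ measureReal_nonneg)
  · rw [et, J_univ_right, half_measure]
    exact J_le_left r σ S T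
  · rw [es, et]; exact borell_core hr hσ h hS hT hs ht

instance gp_prob (n : ℕ) : IsProbabilityMeasure (gaussianPi n) := by
  unfold gaussianPi; infer_instance

lemma upd_meas {n : ℕ} (i : Fin n) :
    Measurable (fun q : (Fin n → ℝ) × ℝ => Function.update q.1 i q.2) := by
  rw [measurable_pi_iff]
  intro j
  by_cases h : j = i
  · subst h; simpa using measurable_snd
  · simp only [Function.update_of_ne h]; fun_prop

lemma upd_mp {n : ℕ} (i : Fin n) :
    ((gaussianPi n).prod _root_.stdGaussian).map
      (fun q : (Fin n → ℝ) × ℝ => Function.update q.1 i q.2) = gaussianPi n := by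
  unfold gaussianPi
  symm
  refine Measure.pi_eq fun s hs => ?_
  rw [Measure.map_apply (upd_meas i) (MeasurableSet.univ_pi hs)]
  have : (fun q : (Fin n → ℝ) × ℝ => Function.update q.1 i q.2) ⁻¹' (univ.pi s)
      = (univ.pi (Function.update s i univ)) ×ˢ s i := by
    ext ⟨x, y⟩
    simp only [mem_preimage, Set.mem_pi, mem_univ, true_implies, mem_prod]
    constructor
    · intro h
      refine ⟨fun j => ?_, by simpa using h i⟩
      by_cases hj : j = i
      · subst hj; simp
      · simpa [hj] using h j
    · rintro ⟨h1, h2⟩ j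
      by_cases hj : j = i
      · subst hj; simpa using h2
      · simpa [hj] using h1 j
  rw [this, Measure.prod_prod, Measure.pi_pi, ← Finset.prod_erase_mul Finset.univ _ (Finset.mem_univ i),
    ← Finset.prod_erase_mul Finset.univ (fun i => _root_.stdGaussian (s i)) (Finset.mem_univ i)]
  simp only [Function.update_self, measure_univ, mul_one]
  congr 1
  refine Finset.prod_congr rfl fun j hj => ?_
  rw [Function.update_of_ne (Finset.ne_of_mem_erase hj)]

lemma upd_lint {n : ℕ} (i : Fin n) {f : (Fin n → ℝ) → ENNReal} (hf : Measurable f) :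
    ∫⁻ x, f x ∂gaussianPi n
      = ∫⁻ x, ∫⁻ y, f (Function.update x i y) ∂_root_.stdGaussian ∂gaussianPi n := by
  conv_lhs => rw [← upd_mp i]
  rw [lintegral_map hf (upd_meas i), 
    lintegral_prod (fun q : (Fin n → ℝ) × ℝ => f (Function.update q.1 i q.2))
      (hf.comp (upd_meas i)).aemeasurable]

lemma upd_lint2 {n : ℕ} (i : Fin n) {f : (Fin n → ℝ) × (Fin n → ℝ) → ENNReal} (hf : Measurable f) :
    ∫⁻ p, f p ∂((gaussianPi n).prod (gaussianPi n))
      = ∫⁻ p, ∫⁻ q, f (Function.update p.1 i q.1, Function.update p.2 i q.2)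
        ∂(_root_.stdGaussian.prod _root_.stdGaussian) ∂((gaussianPi n).prod (gaussianPi n)) := by
  have hu := upd_meas i
  have hu1 : ∀ {α : Type} [MeasurableSpace α] {g : α → Fin n → ℝ} {k : α → ℝ}, Measurable g →
      Measurable k → Measurable fun a => Function.update (g a) i (k a) :=
    fun hg hk => hu.comp (hg.prodMk hk)
  have hF : Measurable fun z : ((Fin n → ℝ) × (Fin n → ℝ)) × (ℝ × ℝ) =>
      f (Function.update z.1.1 i z.2.1, Function.update z.1.2 i z.2.2) :=
    hf.comp ((hu1 (by fun_prop) (by fun_prop)).prodMk (hu1 (by fun_prop) (by fun_prop)))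
  rw [lintegral_prod _ hf.aemeasurable, lintegral_prod _ (Measurable.lintegral_prod_right' hF).aemeasurable,
    upd_lint i (Measurable.lintegral_prod_right' hf)]
  refine lintegral_congr fun x => ?_
  have e1 : ∀ x' : Fin n → ℝ, ∫⁻ q, f (Function.update x i q.1, Function.update x' i q.2)
        ∂(_root_.stdGaussian.prod _root_.stdGaussian)
      = ∫⁻ y, ∫⁻ y', f (Function.update x i y, Function.update x' i y') ∂_root_.stdGaussian
        ∂_root_.stdGaussian := fun x' =>
    lintegral_prod _ (hf.comp ((hu1 measurable_const measurable_fst).prodMk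
      (hu1 measurable_const measurable_snd))).aemeasurable
  simp only [e1]
  symm
  rw [lintegral_lintegral_swap]
  · refine lintegral_congr fun y => ?_
    exact (upd_lint i (f := fun x' => f (Function.update x i y, x'))
      (hf.comp (measurable_const.prodMk measurable_id))).symm
  · refine Measurable.aemeasurable ?_
    refine Measurable.lintegral_prod_right' (f := fun z : ((Fin n → ℝ) × ℝ) × ℝ =>
      f (Function.update x i z.1.2, Function.update z.1.1 i z.2)) ?_
    exact hf.comp ((hu1 (by fun_prop) (by fun_prop)).prodMk (hu1 (by fun_prop) (by fun_prop)))

lemma noised_meas {n : ℕ} (ρ : ℝ) :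
    Measurable (noised ρ : (Fin n → ℝ) × (Fin n → ℝ) → Fin n → ℝ) := by
  unfold noised; fun_prop

lemma noised_upd {n : ℕ} (ρ : ℝ) (p : (Fin n → ℝ) × (Fin n → ℝ)) (i : Fin n) (y y' : ℝ) :
    noised ρ (Function.update p.1 i y, Function.update p.2 i y')
      = Function.update (noised ρ p) i (Real.sqrt (1 - ρ ^ 2) * y + ρ * y') := by
  ext j
  by_cases h : j = i
  · subst h; simp [noised]
  · simp [noised, h]

lemma Zset_meas {n : ℕ} {A : Set (Fin n → ℝ)} (hA : MeasurableSet A) (ρ : ℝ) :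
    MeasurableSet {p : (Fin n → ℝ) × (Fin n → ℝ) | p.1 ∈ A ∧ noised ρ p ∈ A} :=
  (measurable_fst hA).inter (noised_meas ρ hA)

lemma gaussZ_eq {n : ℕ} {A : Set (Fin n → ℝ)} (hA : MeasurableSet A) (ρ : ℝ) :
    gaussZ (A.indicator 1) ρ = ((gaussianPi n).prod (gaussianPi n)).real
      {p | p.1 ∈ A ∧ noised ρ p ∈ A} := by
  rw [← integral_indicator_one (Zset_meas hA ρ)]
  unfold gaussZ
  congr 1; ext p
  by_cases h1 : p.1 ∈ A <;> by_cases h2 : noised ρ p ∈ A <;> simp [h1, h2]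

lemma Z_fubini {n : ℕ} {A : Set (Fin n → ℝ)} (hA : MeasurableSet A) (i : Fin n) (ρ : ℝ) :
    ((gaussianPi n).prod (gaussianPi n)) {p | p.1 ∈ A ∧ noised ρ p ∈ A}
      = ∫⁻ p, ENNReal.ofReal (Jf (Real.sqrt (1 - ρ ^ 2)) ρ (fiber A i p.1) (fiber A i (noised ρ p)))
        ∂((gaussianPi n).prod (gaussianPi n)) := by
  rw [← lintegral_indicator_one (Zset_meas hA ρ),
    upd_lint2 i (measurable_one.indicator (Zset_meas hA ρ))]
  refine lintegral_congr fun p => ?_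
  rw [Jf, ofReal_measureReal]
  have hm : ∀ x : Fin n → ℝ, MeasurableSet (fiber A i x) := fun x =>
    (upd_meas i).comp (measurable_const.prodMk measurable_id) hA
  rw [← lintegral_indicator_one (J_meas _ _ (hm _) (hm _))]
  refine lintegral_congr fun q => ?_
  have e := noised_upd ρ p i q.1 q.2
  by_cases hq : q.1 ∈ fiber A i p.1 ∧
      Real.sqrt (1 - ρ ^ 2) * q.1 + ρ * q.2 ∈ fiber A i (noised ρ p)
  · rw [indicator_of_mem, indicator_of_mem]
    · rfl
    · exact hq
    · exact ⟨hq.1, by rw [e]; exact hq.2⟩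
  · rw [indicator_of_notMem, indicator_of_notMem]
    · exact hq
    · rintro ⟨h1, h2⟩
      rw [e] at h2
      exact hq ⟨h1, h2⟩

lemma fiber_shift {n : ℕ} (A : Set (Fin n → ℝ)) (i : Fin n) (x : Fin n → ℝ) :
    fiber (shiftOp i A) i x = half (_root_.stdGaussian.real (fiber A i x)) := by
  ext y
  simp only [fiber, shiftOp, half, mem_ofPred_eq, Function.update_self, Function.update_idem]
  rfl

lemma fiber_meas {n : ℕ} {A : Set (Fin n → ℝ)} (hA : MeasurableSet A) (i : Fin n)
    (x : Fin n → ℝ) : MeasurableSet (fiber A i x) :=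
  (upd_meas i).comp (measurable_const.prodMk measurable_id) hA

lemma shiftOp_meas {n : ℕ} {A : Set (Fin n → ℝ)} (hA : MeasurableSet A) (i : Fin n) :
    MeasurableSet (shiftOp i A) := by
  have h1 : Measurable fun x : Fin n → ℝ => (_root_.stdGaussian (fiber A i x)).toReal :=
    (measurable_measure_prodMk_left (ν := _root_.stdGaussian) (upd_meas i hA)).ennreal_toReal
  exact measurableSet_le
    (measurable_const.sub (Phi_continuous.measurable.comp (measurable_pi_apply i))) h1

lemma shift_one {n : ℕ} {A : Set (Fin n → ℝ)} (hA : MeasurableSet A) (i : Fin n) {ρ : ℝ}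
    (hρ : ρ ∈ Set.Ioo (0 : ℝ) 1) :
    gaussZ (A.indicator 1) ρ ≤ gaussZ ((shiftOp i A).indicator 1) ρ := by
  have hB := shiftOp_meas hA i
  rw [gaussZ_eq hA, gaussZ_eq hB]
  refine ENNReal.toReal_mono (measure_ne_top _ _) ?_
  rw [Z_fubini hA i, Z_fubini hB i]
  refine lintegral_mono fun p => ENNReal.ofReal_le_ofReal ?_
  rw [fiber_shift, fiber_shift]
  have hpos : 0 < 1 - ρ ^ 2 := by nlinarith [hρ.1, hρ.2]
  refine borell (Real.sqrt_pos.2 hpos) hρ.1 ?_ (fiber_meas hA i _) (fiber_meas hA i _)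
  rw [Real.sq_sqrt hpos.le]; ring

lemma shift_list {n : ℕ} {A : Set (Fin n → ℝ)} (hA : MeasurableSet A) {ρ : ℝ}
    (hρ : ρ ∈ Set.Ioo (0 : ℝ) 1) (l : List (Set (Fin n → ℝ) → Set (Fin n → ℝ)))
    (hl : ∀ m ∈ l, ∃ i, m = shiftOp i) :
    MeasurableSet (l.foldr (fun m B => m B) A) ∧
    gaussZ (A.indicator 1) ρ ≤ gaussZ ((l.foldr (fun m B => m B) A).indicator 1) ρ := by
  induction l with
  | nil => exact ⟨hA, le_rfl⟩
  | cons m l ih =>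
    obtain ⟨h1, h2⟩ := ih fun m' hm' => hl m' (List.mem_cons_of_mem _ hm')
    obtain ⟨i, rfl⟩ := hl m List.mem_cons_self
    exact ⟨shiftOp_meas h1 i, h2.trans (shift_one h1 i hρ)⟩

end Aux

/-- **Lemma (shifting cannot decrease Gaussian noise correlation).**
For any Borel set `A ⊆ ℝⁿ`, any coordinate `i` and any `ρ ∈ (0,1)`,
`Z^G(M_i(A), ρ) ≥ Z^G(A, ρ)`; consequently `Z^G(M(A), ρ) ≥ Z^G(A, ρ)`. -/
theorem shift_increases_gaussZ (n : ℕ) (A : Set (Fin n → ℝ)) (hA : MeasurableSet A)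
    (i : Fin n) (ρ : ℝ) (hρ : ρ ∈ Set.Ioo (0 : ℝ) 1) :
    gaussZ ((shiftOp i A).indicator 1) ρ ≥ gaussZ (A.indicator 1) ρ ∧
    gaussZ ((shiftAll n A).indicator 1) ρ ≥ gaussZ (A.indicator 1) ρ := by
  refine ⟨shift_one hA i hρ, ?_⟩
  refine (shift_list hA hρ _ fun m hm => ?_).2
  obtain ⟨j, rfl⟩ := (List.mem_ofFn' _ _).1 hm
  exact ⟨j, rfl⟩
end
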